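/- Let K ⊆ ℝ² be a convex set containing the origin, let 0 < κ ≤ 1/10, and let F be an arc of the unit circle of angular measure t with 0 < t < π whose two endpoints belong to K. Let F_{1−κ} = {(1−κ)z : z ∈ F}. Then the angular measure of F_{1−κ} ∩ K is at least (t · κ · cos(t/2))/2. -/

import Mathlib

open MeasureTheory Real

/-- The point `(cos θ, sin θ)` on the unit circle in `ℝ²`. -/
noncomputable def unitPt (θ : ℝ) : EuclideanSpace ℝ (Fin 2) :=
  (EuclideanSpace.equiv (Fin 2) ℝ).symm ![Real.cos θ, Real.sin θ]

/-- The angular measure (arclength divided by the radius) of a subset `A` of the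
origin-centered circle of radius `r` in `ℝ²`: the Lebesgue measure of the set of
angles `θ ∈ [0, 2π)` whose corresponding point of the radius-`r` circle lies in `A`. -/
noncomputable def angularMeasure (r : ℝ) (A : Set (EuclideanSpace ℝ (Fin 2))) : ℝ :=
  (volume {θ : ℝ | θ ∈ Set.Ico 0 (2 * Real.pi) ∧ r • unitPt θ ∈ A}).toReal

/-- A periodic set containing a measurable subset `A` of one period has measure at least
`volume A` in the period starting at `0`. -/
lemma volume_le_volume_Ico_inter_of_periodic {T a : ℝ} (hT : 0 < T) {A S : Set ℝ}
    (hA : MeasurableSet A) (hAa : A ⊆ Set.Ioc a (a + T)) (hAS : A ⊆ S)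
    (hS : ∀ (n : ℤ) (x : ℝ), x + n * T ∈ S → x ∈ S) :
    volume A ≤ volume (Set.Ico 0 T ∩ S) := by
  set Q : Set ℝ := ⋃ n : ℤ, (fun x : ℝ => x + n * T) ⁻¹' A with hQ
  have hQm : MeasurableSet Q :=
    MeasurableSet.iUnion fun n => (measurable_id.add_const _) hA
  have hQS : Q ⊆ S := by
    intro x hx
    obtain ⟨n, hn⟩ := Set.mem_iUnion.1 hx
    exact hS n x (hAS hn)
  have hAQ : A ⊆ Q := fun x hx => Set.mem_iUnion.2 ⟨0, by simpa using hx⟩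
  have hinv : ∀ g : AddSubgroup.zmultiples T, (fun x => g +ᵥ x) ⁻¹' Q = Q := by
    rintro ⟨g, hg⟩
    obtain ⟨m, rfl⟩ := AddSubgroup.mem_zmultiples_iff.1 hg
    ext x
    simp only [hQ, Set.mem_preimage, Set.mem_iUnion, AddSubgroup.vadd_def, vadd_eq_add,
      zsmul_eq_mul]
    constructor
    · rintro ⟨n, hn⟩
      refine ⟨n + m, ?_⟩
      convert hn using 1
      push_cast
      ring
    · rintro ⟨n, hn⟩
      refine ⟨n - m, ?_⟩
      convert hn using 1
      push_cast
      ring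
  have heq := (isAddFundamentalDomain_Ioc hT a volume).measure_set_eq
    (isAddFundamentalDomain_Ioc hT 0 volume) hQm hinv
  calc volume A ≤ volume (Q ∩ Set.Ioc a (a + T)) :=
        measure_mono (Set.subset_inter hAQ hAa)
    _ = volume (Q ∩ Set.Ioc 0 T) := by rw [heq, zero_add]
    _ = volume (Q ∩ Set.Ico 0 T) :=
        measure_congr ((Filter.EventuallyEq.refl _ Q).inter Ico_ae_eq_Ioc.symm)
    _ ≤ volume (Set.Ico 0 T ∩ S) :=
        measure_mono fun x hx => ⟨hx.2, hQS hx.1⟩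

lemma unitPt_add_int_mul_two_pi (θ : ℝ) (n : ℤ) :
    unitPt (θ + n * (2 * π)) = unitPt θ := by
  simp [unitPt, Real.cos_add_int_mul_two_pi, Real.sin_add_int_mul_two_pi]

lemma sin_smul_unitPt_add (θ s t : ℝ) :
    sin t • unitPt (θ + s) = sin (t - s) • unitPt θ + sin s • unitPt (θ + t) := by
  ext i
  fin_cases i
  · simp [unitPt, Real.cos_add, Real.sin_sub]
    ring
  · simp [unitPt, Real.sin_add, Real.sin_sub]
    ring

/-- A point of the sector spanned by two unit vectors at angle `t` lies in every convex set
containing the origin and both vectors, provided it is on the origin's side of their chord. -/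
lemma smul_unitPt_mem_of_mul_cos_le {K : Set (EuclideanSpace ℝ (Fin 2))} (hK : Convex ℝ K)
    (h0 : (0 : EuclideanSpace ℝ (Fin 2)) ∈ K) {r t s θ : ℝ} (hr : 0 ≤ r) (ht : 0 < t)
    (htπ : t < π) (h₁ : unitPt θ ∈ K) (h₂ : unitPt (θ + t) ∈ K) (hs : 0 ≤ s) (hst : s ≤ t)
    (hcos : r * cos (t / 2 - s) ≤ cos (t / 2)) : r • unitPt (θ + s) ∈ K := by
  have hsin : 0 < sin t := sin_pos_of_pos_of_lt_pi ht htπ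
  have hsin' : 0 < sin (t / 2) := sin_pos_of_pos_of_lt_pi (by linarith) (by linarith)
  have ha : 0 ≤ r * sin (t - s) / sin t :=
    div_nonneg (mul_nonneg hr (sin_nonneg_of_nonneg_of_le_pi (by linarith) (by linarith))) hsin.le
  have hb : 0 ≤ r * sin s / sin t :=
    div_nonneg (mul_nonneg hr (sin_nonneg_of_nonneg_of_le_pi hs (by linarith))) hsin.le
  have hsum : r * sin (t - s) / sin t + r * sin s / sin t ≤ 1 := by
    rw [← add_div, div_le_one hsin]
    have e₁ : sin (t - s) = sin (t / 2) * cos (t / 2 - s) + cos (t / 2) * sin (t / 2 - s) := by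
      rw [← sin_add]; congr 1; ring
    have e₂ : sin s = sin (t / 2) * cos (t / 2 - s) - cos (t / 2) * sin (t / 2 - s) := by
      rw [← sin_sub]; congr 1; ring
    have e₃ : sin t = 2 * sin (t / 2) * cos (t / 2) := by
      rw [← sin_two_mul]; congr 1; ring
    rw [e₁, e₂, e₃]
    nlinarith [mul_le_mul_of_nonneg_left hcos hsin'.le]
  have hpt : r • unitPt (θ + s) =
      (r * sin (t - s) / sin t) • unitPt θ + (r * sin s / sin t) • unitPt (θ + t) +
        (1 - (r * sin (t - s) / sin t + r * sin s / sin t)) •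
          (0 : EuclideanSpace ℝ (Fin 2)) := by
    have h := congrArg (fun v => (r / sin t) • v) (sin_smul_unitPt_add θ s t)
    simp only [smul_add, smul_smul, div_mul_cancel₀ _ hsin.ne'] at h
    rw [h, smul_zero, add_zero, div_mul_eq_mul_div, div_mul_eq_mul_div]
  rw [hpt]
  have := hK.sum_mem (t := Finset.univ)
    (w := ![r * sin (t - s) / sin t, r * sin s / sin t,
      1 - (r * sin (t - s) / sin t + r * sin s / sin t)])
    (z := ![unitPt θ, unitPt (θ + t), 0])
    (by intro i _; fin_cases i <;> simp [ha, hb, hsum])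
    (by simp [Fin.sum_univ_three])
    (by intro i _; fin_cases i <;> simp [h0, h₁, h₂])
  simpa [Fin.sum_univ_three] using this

lemma mul_cos_sub_le_cos {κ φ s : ℝ} (hκ : 0 < κ) (hκ' : κ ≤ 1) (hφ : 0 < φ)
    (hφ' : φ < π / 2) (hs : 0 ≤ s) (hsδ : s ≤ φ * κ * cos φ / 2) :
    (1 - κ) * cos (φ - s) ≤ cos φ := by
  have hc : 0 < cos φ := cos_pos_of_mem_Ioo ⟨by linarith, hφ'⟩
  have hsφ : 0 ≤ sin φ := sin_nonneg_of_nonneg_of_le_pi hφ.le (by linarith)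
  have hφ2 : φ ≤ 2 := by linarith [pi_le_four]
  have h₁ : cos (φ - s) ≤ cos φ + s := by
    rw [cos_sub]
    have := mul_le_mul_of_nonneg_left (cos_le_one s) hc.le
    have := mul_le_mul_of_nonneg_left (sin_le hs) hsφ
    have := mul_le_mul_of_nonneg_right (sin_le_one φ) hs
    linarith
  have h₂ : φ * κ * cos φ / 2 ≤ κ * cos φ := by
    nlinarith [mul_nonneg (mul_pos hκ hc).le (sub_nonneg.2 hφ2)]
  calc (1 - κ) * cos (φ - s) ≤ (1 - κ) * (cos φ + κ * cos φ) :=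
        mul_le_mul_of_nonneg_left (by linarith) (by linarith)
    _ ≤ cos φ := by nlinarith [mul_pos (mul_pos hκ hκ) hc]

/-- Claim 2.7 of the paper: if `K ⊆ ℝ²` is convex with `0 ∈ K`, and `F` is an arc of
the unit circle of angular measure `t ∈ (0, π)` whose endpoints lie in `K`, then the
radial contraction `F_{1-κ}` of `F` meets `K` in angular measure at least
`t·κ·cos(t/2)/2`. -/
theorem arc_contraction_gain :
    ∀ (K : Set (EuclideanSpace ℝ (Fin 2))) (κ t θ₀ : ℝ),
      Convex ℝ K → (0 : EuclideanSpace ℝ (Fin 2)) ∈ K →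
      0 < κ → κ ≤ 1 / 10 →
      0 < t → t < Real.pi →
      unitPt θ₀ ∈ K → unitPt (θ₀ + t) ∈ K →
      t * κ * Real.cos (t / 2) / 2 ≤
        angularMeasure (1 - κ)
          (((fun z => (1 - κ) • z) '' (unitPt '' Set.Icc θ₀ (θ₀ + t))) ∩ K) := by
  intro K κ t θ₀ hK h0 hκ hκ' ht htπ h₁ h₂
  set B := ((fun z => (1 - κ) • z) '' (unitPt '' Set.Icc θ₀ (θ₀ + t))) ∩ K with hB
  have hc : 0 < cos (t / 2) := cos_pos_of_mem_Ioo ⟨by linarith, by linarith⟩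
  set δ : ℝ := t / 2 * κ * cos (t / 2) / 2 with hδ
  have hδ0 : 0 < δ := by positivity
  have hδt : δ ≤ t / 4 := by
    have : κ * cos (t / 2) ≤ 1 := mul_le_one₀ (by linarith) hc.le (cos_le_one _)
    nlinarith
  have hmem : ∀ s, 0 ≤ s → s ≤ t → (1 - κ) * cos (t / 2 - s) ≤ cos (t / 2) →
      (1 - κ) • unitPt (θ₀ + s) ∈ B := fun s hs hst hcos =>
    ⟨⟨_, ⟨θ₀ + s, ⟨by linarith, by linarith⟩, rfl⟩, rfl⟩,
      smul_unitPt_mem_of_mul_cos_le hK h0 (by linarith) ht htπ h₁ h₂ hs hst hcos⟩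
  have hcos : ∀ s, 0 ≤ s → s ≤ δ → (1 - κ) * cos (t / 2 - s) ≤ cos (t / 2) := fun s hs hsδ =>
    mul_cos_sub_le_cos hκ (by linarith) (by linarith) (by linarith) hs hsδ
  set A : Set ℝ := Set.Ioc θ₀ (θ₀ + δ) ∪ Set.Ioc (θ₀ + t - δ) (θ₀ + t) with hA
  have hAB : A ⊆ {θ | (1 - κ) • unitPt θ ∈ B} := by
    rintro θ (⟨hl, hu⟩ | ⟨hl, hu⟩)
    · have := hmem (θ - θ₀) (by linarith) (by linarith)
        (hcos _ (by linarith) (by linarith))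
      rwa [add_sub_cancel] at this
    · have := hmem (θ - θ₀) (by linarith) (by linarith) (by
        rw [← cos_neg, show -(t / 2 - (θ - θ₀)) = t / 2 - (θ₀ + t - θ) by ring]
        exact hcos _ (by linarith) (by linarith))
      rwa [add_sub_cancel] at this
  have hvol : volume A = ENNReal.ofReal (2 * δ) := by
    rw [hA, measure_union _ measurableSet_Ioc, Real.volume_Ioc, Real.volume_Ioc,
      ← ENNReal.ofReal_add (by linarith) (by linarith)]
    · congr 1
      ring
    · exact Set.Ioc_disjoint_Ioc_of_le (by linarith)
  have hle : volume A ≤ volume (Set.Ico 0 (2 * π) ∩ {θ | (1 - κ) • unitPt θ ∈ B}) := by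
    refine volume_le_volume_Ico_inter_of_periodic (a := θ₀) two_pi_pos
      (measurableSet_Ioc.union measurableSet_Ioc) ?_ hAB ?_
    · rintro θ (⟨hl, hu⟩ | ⟨hl, hu⟩) <;> constructor <;> linarith
    · intro n θ hθ
      simpa only [Set.mem_ofPred_eq, unitPt_add_int_mul_two_pi] using hθ
  have hfin : volume (Set.Ico 0 (2 * π) ∩ {θ | (1 - κ) • unitPt θ ∈ B}) ≠ ⊤ :=
    measure_ne_top_of_subset Set.inter_subset_left measure_Ico_lt_top.ne
  calc t * κ * cos (t / 2) / 2 = 2 * δ := by rw [hδ]; ring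
    _ = (volume A).toReal := by rw [hvol, ENNReal.toReal_ofReal (by linarith)]
    _ ≤ _ := ENNReal.toReal_mono hfin hle
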